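/- Assume 2 < sp < p and that K is nonempty. Suppose u₁, u₂ ∈ K both solve the variational inequality: a_p(u_i, v − u_i) − ∫_Ω f (v − u_i) dx ≥ 0 for every v ∈ K (i = 1,2). Then E_{s,p}(u₁ − u₂) = 0 and ∫_{∂Ω} b |u₁ − u₂|^p dμ = 0. In particular, u₁ − u₂ equals a constant almost everywhere on Ω with respect to Lebesgue measure, and u₁ = u₂ μ-almost everywhere on ∂Ω. -/

import Mathlib

open MeasureTheory Set
open scoped ENNReal

noncomputable section

/-- The Gagliardo energy `E_{s,p}(v) = ∬_{Ω×Ω} |v(x)−v(y)|^p / |x−y|^{2+sp} dx dy ∈ [0,∞]`. -/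
def gagliardoEnergy (Ω : Set (EuclideanSpace ℝ (Fin 2))) (s p : ℝ)
    (v : EuclideanSpace ℝ (Fin 2) → ℝ) : ℝ≥0∞ :=
  ∫⁻ x in Ω, ∫⁻ y in Ω, ENNReal.ofReal (|v x - v y| ^ p / ‖x - y‖ ^ (2 + s * p))

/-- The boundary term `∫_{∂Ω} b |v|^p dμ ∈ [0,∞]`. -/
def boundaryTerm (μb : Measure (EuclideanSpace ℝ (Fin 2))) (b : EuclideanSpace ℝ (Fin 2) → ℝ)
    (p : ℝ) (v : EuclideanSpace ℝ (Fin 2) → ℝ) : ℝ≥0∞ :=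
  ∫⁻ x, ENNReal.ofReal (b x * |v x| ^ p) ∂μb

/-- The admissible convex set `K`. -/
def memK (Ω : Set (EuclideanSpace ℝ (Fin 2))) (μb : Measure (EuclideanSpace ℝ (Fin 2)))
    (s p : ℝ) (f b φ₁ φ₂ v : EuclideanSpace ℝ (Fin 2) → ℝ) : Prop :=
  Measurable v ∧
  (∀ᵐ x ∂(volume.restrict Ω), φ₁ x ≤ v x ∧ v x ≤ φ₂ x) ∧
  MemLp v (ENNReal.ofReal p) (volume.restrict Ω) ∧
  Integrable (fun x => f x * v x) (volume.restrict Ω) ∧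
  gagliardoEnergy Ω s p v < ∞ ∧
  boundaryTerm μb b p v < ∞

/-- The form
`a_p(u,v) = ∬_{Ω×Ω} |u(x)−u(y)|^{p−2}(u(x)−u(y))(v(x)−v(y))/|x−y|^{2+sp} dx dy
  + ∫_{∂Ω} b |u|^{p−2} u v dμ`. -/
def apForm (Ω : Set (EuclideanSpace ℝ (Fin 2))) (μb : Measure (EuclideanSpace ℝ (Fin 2)))
    (s p : ℝ) (b u v : EuclideanSpace ℝ (Fin 2) → ℝ) : ℝ :=
  (∫ x in Ω, ∫ y in Ω,
      |u x - u y| ^ (p - 2) * (u x - u y) * (v x - v y) / ‖x - y‖ ^ (2 + s * p)) +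
    ∫ x, b x * |u x| ^ (p - 2) * u x * v x ∂μb

theorem strictMono_abs_rpow_mul {p : ℝ} (hp : 2 < p) :
    StrictMono fun t : ℝ => |t| ^ (p - 2) * t := by
  refine strictMono_of_odd_strictMonoOn_nonneg (fun t => by simp) fun a ha c _ hac => ?_
  have ha' : 0 ≤ a := ha
  have hc : 0 < c := ha'.trans_lt hac
  simp only [abs_of_nonneg ha', abs_of_pos hc]
  calc a ^ (p - 2) * a ≤ c ^ (p - 2) * a := by gcongr
    _ < c ^ (p - 2) * c := by gcongr

theorem abs_abs_rpow_mul_mul_le {p : ℝ} (hp : 2 < p) (x y : ℝ) :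
    |(|x| ^ (p - 2) * x) * y| ≤ |x| ^ p + |y| ^ p := by
  have key : ∀ m : ℝ, 0 ≤ m → m ^ (p - 2) * m * m = m ^ p := fun m hm => by
    rw [mul_assoc, ← sq, ← Real.rpow_natCast m 2, ← Real.rpow_add_of_nonneg hm (by linarith)
      (by norm_num)]
    congr 1
    push_cast
    ring
  have hx := Real.rpow_nonneg (abs_nonneg x) p
  have hy := Real.rpow_nonneg (abs_nonneg y) p
  rw [abs_mul, abs_mul, abs_of_nonneg (Real.rpow_nonneg (abs_nonneg x) _)]
  rcases le_total |x| |y| with h | h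
  · calc |x| ^ (p - 2) * |x| * |y| ≤ |y| ^ (p - 2) * |y| * |y| := by gcongr
      _ ≤ _ := by rw [key _ (abs_nonneg y)]; linarith
  · calc |x| ^ (p - 2) * |x| * |y| ≤ |x| ^ (p - 2) * |x| * |x| := by gcongr
      _ ≤ _ := by rw [key _ (abs_nonneg x)]; linarith

section Weighted

variable {α : Type*} [MeasurableSpace α] {ν : Measure α} {p : ℝ} {k A B : α → ℝ}

theorem integrable_weight_mul_abs_rpow (hk : Measurable k) (hA : Measurable A)
    (hk0 : ∀ᵐ z ∂ν, 0 ≤ k z) (hAp : ∫⁻ z, ENNReal.ofReal (k z * |A z| ^ p) ∂ν < ∞) :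
    Integrable (fun z => k z * |A z| ^ p) ν := by
  have hm : Measurable fun z => k z * |A z| ^ p := by fun_prop
  refine ⟨hm.aestronglyMeasurable, (hasFiniteIntegral_iff_ofReal ?_).2 hAp⟩
  filter_upwards [hk0] with z hz
  exact mul_nonneg hz (Real.rpow_nonneg (abs_nonneg _) _)

theorem integrable_weight_mul_abs_rpow_mul_mul (hp : 2 < p) (hk : Measurable k)
    (hA : Measurable A) (hB : Measurable B) (hk0 : ∀ᵐ z ∂ν, 0 ≤ k z)
    (hAp : ∫⁻ z, ENNReal.ofReal (k z * |A z| ^ p) ∂ν < ∞)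
    (hBp : ∫⁻ z, ENNReal.ofReal (k z * |B z| ^ p) ∂ν < ∞) :
    Integrable (fun z => k z * |A z| ^ (p - 2) * A z * B z) ν := by
  have hm : Measurable fun z => k z * |A z| ^ (p - 2) * A z * B z := by fun_prop
  refine ((integrable_weight_mul_abs_rpow hk hA hk0 hAp).add
    (integrable_weight_mul_abs_rpow hk hB hk0 hBp)).mono' hm.aestronglyMeasurable ?_
  filter_upwards [hk0] with z hz
  have h := mul_le_mul_of_nonneg_left (abs_abs_rpow_mul_mul_le hp (A z) (B z)) hz
  rw [Real.norm_eq_abs]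
  calc |k z * |A z| ^ (p - 2) * A z * B z| = |k z * (|A z| ^ (p - 2) * A z * B z)| := by
        congr 1; ring
    _ = k z * |(|A z| ^ (p - 2) * A z) * B z| := by rw [abs_mul, abs_of_nonneg hz]
    _ ≤ _ := by simpa [mul_add] using h

theorem integrable_weight_mul_abs_rpow_mul_sub (hp : 2 < p) (hk : Measurable k)
    (hA : Measurable A) (hB : Measurable B) (hk0 : ∀ᵐ z ∂ν, 0 ≤ k z)
    (hAp : ∫⁻ z, ENNReal.ofReal (k z * |A z| ^ p) ∂ν < ∞)
    (hBp : ∫⁻ z, ENNReal.ofReal (k z * |B z| ^ p) ∂ν < ∞) :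
    Integrable (fun z => k z * |A z| ^ (p - 2) * A z * (B z - A z)) ν := by
  simp only [mul_sub]
  exact (integrable_weight_mul_abs_rpow_mul_mul hp hk hA hB hk0 hAp hBp).sub
    (integrable_weight_mul_abs_rpow_mul_mul hp hk hA hA hk0 hAp hAp)

theorem weight_mul_gap_nonneg (hp : 2 < p) {c : ℝ} (hc : 0 ≤ c) (x y : ℝ) :
    0 ≤ -(c * |x| ^ (p - 2) * x * (y - x) + c * |y| ^ (p - 2) * y * (x - y)) := by
  have hmono := (strictMono_abs_rpow_mul hp).monotone
  have h : 0 ≤ (|x| ^ (p - 2) * x - |y| ^ (p - 2) * y) * (x - y) := by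
    rcases le_total x y with hxy | hxy
    · exact mul_nonneg_of_nonpos_of_nonpos (sub_nonpos.2 (hmono hxy)) (sub_nonpos.2 hxy)
    · exact mul_nonneg (sub_nonneg.2 (hmono hxy)) (sub_nonneg.2 hxy)
  calc 0 ≤ c * ((|x| ^ (p - 2) * x - |y| ^ (p - 2) * y) * (x - y)) := mul_nonneg hc h
    _ = _ := by ring

theorem eq_zero_or_eq_of_weight_mul_gap_eq_zero (hp : 2 < p) {c x y : ℝ}
    (h : -(c * |x| ^ (p - 2) * x * (y - x) + c * |y| ^ (p - 2) * y * (x - y)) = 0) :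
    c = 0 ∨ x = y := by
  have h' : c * ((|x| ^ (p - 2) * x - |y| ^ (p - 2) * y) * (x - y)) = 0 := by
    rw [← h]; ring
  rcases mul_eq_zero.1 h' with hc | hxy
  · exact Or.inl hc
  · rcases mul_eq_zero.1 hxy with hxy | hxy
    · exact Or.inr ((strictMono_abs_rpow_mul hp).injective (sub_eq_zero.1 hxy))
    · exact Or.inr (sub_eq_zero.1 hxy)

theorem integral_weight_mul_gap_nonpos (hp : 2 < p) (hk : Measurable k)
    (hA : Measurable A) (hB : Measurable B) (hk0 : ∀ᵐ z ∂ν, 0 ≤ k z)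
    (hAp : ∫⁻ z, ENNReal.ofReal (k z * |A z| ^ p) ∂ν < ∞)
    (hBp : ∫⁻ z, ENNReal.ofReal (k z * |B z| ^ p) ∂ν < ∞) :
    (∫ z, k z * |A z| ^ (p - 2) * A z * (B z - A z) ∂ν) +
      ∫ z, k z * |B z| ^ (p - 2) * B z * (A z - B z) ∂ν ≤ 0 := by
  rw [← integral_add (integrable_weight_mul_abs_rpow_mul_sub hp hk hA hB hk0 hAp hBp)
    (integrable_weight_mul_abs_rpow_mul_sub hp hk hB hA hk0 hBp hAp)]
  refine integral_nonpos_of_ae ?_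
  filter_upwards [hk0] with z hz
  exact neg_nonneg.1 (weight_mul_gap_nonneg hp hz (A z) (B z))

theorem ae_eq_of_integral_weight_mul_gap_nonneg (hp : 2 < p) (hk : Measurable k)
    (hA : Measurable A) (hB : Measurable B) (hk0 : ∀ᵐ z ∂ν, 0 ≤ k z)
    (hAp : ∫⁻ z, ENNReal.ofReal (k z * |A z| ^ p) ∂ν < ∞)
    (hBp : ∫⁻ z, ENNReal.ofReal (k z * |B z| ^ p) ∂ν < ∞)
    (h : 0 ≤ (∫ z, k z * |A z| ^ (p - 2) * A z * (B z - A z) ∂ν) +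
      ∫ z, k z * |B z| ^ (p - 2) * B z * (A z - B z) ∂ν) :
    ∀ᵐ z ∂ν, k z = 0 ∨ A z = B z := by
  have hAB := integrable_weight_mul_abs_rpow_mul_sub hp hk hA hB hk0 hAp hBp
  have hBA := integrable_weight_mul_abs_rpow_mul_sub hp hk hB hA hk0 hBp hAp
  have h0 := le_antisymm (integral_weight_mul_gap_nonpos hp hk hA hB hk0 hAp hBp) h
  rw [← integral_add hAB hBA, ← neg_eq_zero, ← integral_neg] at h0
  have hgap := (integral_eq_zero_iff_of_nonneg_ae
    (by filter_upwards [hk0] with z hz using weight_mul_gap_nonneg hp hz (A z) (B z))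
    (hAB.add hBA).neg).1 h0
  filter_upwards [hgap] with z hz
  exact eq_zero_or_eq_of_weight_mul_gap_eq_zero hp hz

end Weighted

/-- The singular kernel `‖x - y‖^{-(2+sp)}` of the Gagliardo energy. -/
def gagliardoKernel (s p : ℝ) (z : EuclideanSpace ℝ (Fin 2) × EuclideanSpace ℝ (Fin 2)) : ℝ :=
  (‖z.1 - z.2‖ ^ (2 + s * p))⁻¹

theorem measurable_gagliardoKernel (s p : ℝ) : Measurable (gagliardoKernel s p) := by
  unfold gagliardoKernel
  fun_prop

theorem gagliardoKernel_nonneg (s p : ℝ)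
    (z : EuclideanSpace ℝ (Fin 2) × EuclideanSpace ℝ (Fin 2)) : 0 ≤ gagliardoKernel s p z :=
  inv_nonneg.2 (Real.rpow_nonneg (norm_nonneg _) _)

theorem gagliardoEnergy_eq_lintegral_prod (Ω : Set (EuclideanSpace ℝ (Fin 2))) (s p : ℝ)
    {v : EuclideanSpace ℝ (Fin 2) → ℝ} (hv : Measurable v) :
    gagliardoEnergy Ω s p v = ∫⁻ z, ENNReal.ofReal (gagliardoKernel s p z * |v z.1 - v z.2| ^ p)
      ∂((volume.restrict Ω).prod (volume.restrict Ω)) := by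
  have hk := measurable_gagliardoKernel s p
  rw [lintegral_prod _ (by fun_prop)]
  simp only [gagliardoEnergy, gagliardoKernel, div_eq_inv_mul]

theorem apForm_sub_eq (Ω : Set (EuclideanSpace ℝ (Fin 2)))
    (μb : Measure (EuclideanSpace ℝ (Fin 2))) {s p : ℝ} (hp : 2 < p)
    (b : EuclideanSpace ℝ (Fin 2) → ℝ) {u v : EuclideanSpace ℝ (Fin 2) → ℝ}
    (hu : Measurable u) (hv : Measurable v)
    (huE : gagliardoEnergy Ω s p u < ∞) (hvE : gagliardoEnergy Ω s p v < ∞) :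
    apForm Ω μb s p b u (fun x => v x - u x) =
      (∫ z, gagliardoKernel s p z * |u z.1 - u z.2| ^ (p - 2) * (u z.1 - u z.2) *
          ((v z.1 - v z.2) - (u z.1 - u z.2))
        ∂((volume.restrict Ω).prod (volume.restrict Ω))) +
      ∫ x, b x * |u x| ^ (p - 2) * u x * (v x - u x) ∂μb := by
  rw [gagliardoEnergy_eq_lintegral_prod Ω s p hu] at huE
  rw [gagliardoEnergy_eq_lintegral_prod Ω s p hv] at hvE
  have hA : Measurable fun z : EuclideanSpace ℝ (Fin 2) × EuclideanSpace ℝ (Fin 2) =>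
    u z.1 - u z.2 := by fun_prop
  have hB : Measurable fun z : EuclideanSpace ℝ (Fin 2) × EuclideanSpace ℝ (Fin 2) =>
    v z.1 - v z.2 := by fun_prop
  have hker := integrable_weight_mul_abs_rpow_mul_sub hp (measurable_gagliardoKernel s p) hA hB
    (ae_of_all _ (gagliardoKernel_nonneg s p)) huE hvE
  rw [apForm, integral_prod _ hker]
  refine congrArg (· + _) (integral_congr_ae (ae_of_all _ fun x =>
    integral_congr_ae (ae_of_all _ fun y => ?_)))
  simp only [gagliardoKernel, div_eq_mul_inv]
  ring

theorem exists_ae_eq_const_of_ae_ae_eq {α β : Type*} [MeasurableSpace α] {ν : Measure α}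
    [NeZero ν] {w : α → β} (h : ∀ᵐ x ∂ν, ∀ᵐ y ∂ν, w x = w y) : ∃ c, ∀ᵐ y ∂ν, w y = c := by
  obtain ⟨x, hx⟩ := h.exists
  exact ⟨w x, hx.mono fun _ hy => hy.symm⟩

/-- **Theorem 2.6 (uniqueness)**: for `2 < sp < p` and `K ≠ ∅`, if `u₁, u₂ ∈ K` both solve the
variational inequality then `E_{s,p}(u₁−u₂) = 0` and `∫_{∂Ω} b |u₁−u₂|^p dμ = 0`. In particular
`u₁ − u₂` is a.e. constant on `Ω` (Lebesgue measure) and `u₁ = u₂` `μ`-a.e. on `∂Ω`. -/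
theorem stmt8 (Ω : Set (EuclideanSpace ℝ (Fin 2))) (hne : Ω.Nonempty) (hop : IsOpen Ω)
    (hbd : Bornology.IsBounded Ω)
    (s p : ℝ) (hs : s ∈ Ioo (0:ℝ) 1) (hp : 1 < p) (h2sp : 2 < s * p) (hspp : s * p < p)
    (f b φ₁ φ₂ : EuclideanSpace ℝ (Fin 2) → ℝ)
    (hf : Integrable f (volume.restrict Ω))
    (hbcont : Continuous b) (hbpos : ∀ x ∈ closure Ω, 0 < b x)
    (hφ₁ : Measurable φ₁) (hφ₂ : Measurable φ₂)
    (hφ : ∀ᵐ x ∂(volume.restrict Ω), φ₁ x ≤ φ₂ x)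
    (μb : Measure (EuclideanSpace ℝ (Fin 2)))
    (hμb : μb = (μH[Real.log 4 / Real.log 3]).restrict (frontier Ω))
    (hKne : ∃ v, memK Ω μb s p f b φ₁ φ₂ v)
    (u₁ u₂ : EuclideanSpace ℝ (Fin 2) → ℝ)
    (hu₁ : memK Ω μb s p f b φ₁ φ₂ u₁) (hu₂ : memK Ω μb s p f b φ₁ φ₂ u₂)
    (hVI₁ : ∀ v, memK Ω μb s p f b φ₁ φ₂ v →
      0 ≤ apForm Ω μb s p b u₁ (fun x => v x - u₁ x) - ∫ x in Ω, f x * (v x - u₁ x))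
    (hVI₂ : ∀ v, memK Ω μb s p f b φ₁ φ₂ v →
      0 ≤ apForm Ω μb s p b u₂ (fun x => v x - u₂ x) - ∫ x in Ω, f x * (v x - u₂ x)) :
    gagliardoEnergy Ω s p (fun x => u₁ x - u₂ x) = 0 ∧
    boundaryTerm μb b p (fun x => u₁ x - u₂ x) = 0 ∧
    (∃ c : ℝ, ∀ᵐ x ∂(volume.restrict Ω), u₁ x - u₂ x = c) ∧
    (∀ᵐ x ∂μb, u₁ x = u₂ x) := by
  have hp2 : 2 < p := h2sp.trans hspp
  have hp0 : p ≠ 0 := by linarith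
  obtain ⟨hm₁, -, -, -, hE₁, hB₁⟩ := id hu₁
  obtain ⟨hm₂, -, -, -, hE₂, hB₂⟩ := id hu₂
  have hbpos' : ∀ᵐ x ∂μb, 0 < b x := by
    rw [hμb]
    filter_upwards [ae_restrict_mem isClosed_frontier.measurableSet] with x hx
    exact hbpos x (frontier_subset_closure hx)
  have hb0 : ∀ᵐ x ∂μb, 0 ≤ b x := hbpos'.mono fun _ hx => hx.le
  have h₁ := hVI₁ u₂ hu₂
  have h₂ := hVI₂ u₁ hu₁
  rw [apForm_sub_eq Ω μb hp2 b hm₁ hm₂ hE₁ hE₂] at h₁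
  rw [apForm_sub_eq Ω μb hp2 b hm₂ hm₁ hE₂ hE₁] at h₂
  have hfneg : ∫ x in Ω, f x * (u₁ x - u₂ x) = -∫ x in Ω, f x * (u₂ x - u₁ x) := by
    rw [← integral_neg]
    congr 1 with x
    ring
  rw [gagliardoEnergy_eq_lintegral_prod Ω s p hm₁] at hE₁
  rw [gagliardoEnergy_eq_lintegral_prod Ω s p hm₂] at hE₂
  have hk := measurable_gagliardoKernel s p
  have hk0 : ∀ᵐ z ∂((volume.restrict Ω).prod (volume.restrict Ω)), 0 ≤ gagliardoKernel s p z :=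
    ae_of_all _ (gagliardoKernel_nonneg s p)
  have hA₁ : Measurable fun z : EuclideanSpace ℝ (Fin 2) × EuclideanSpace ℝ (Fin 2) =>
    u₁ z.1 - u₁ z.2 := by fun_prop
  have hA₂ : Measurable fun z : EuclideanSpace ℝ (Fin 2) × EuclideanSpace ℝ (Fin 2) =>
    u₂ z.1 - u₂ z.2 := by fun_prop
  have hI := integral_weight_mul_gap_nonpos hp2 hk hA₁ hA₂ hk0 hE₁ hE₂
  have hJ := integral_weight_mul_gap_nonpos hp2 hbcont.measurable hm₁ hm₂ hb0 hB₁ hB₂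
  have hker := ae_eq_of_integral_weight_mul_gap_nonneg hp2 hk hA₁ hA₂ hk0 hE₁ hE₂ (by linarith)
  have hbdry := ae_eq_of_integral_weight_mul_gap_nonneg hp2 hbcont.measurable hm₁ hm₂ hb0 hB₁ hB₂
    (by linarith)
  have hbdry' : ∀ᵐ x ∂μb, u₁ x = u₂ x := by
    filter_upwards [hbdry, hbpos'] with x hx hbx
    exact hx.resolve_left hbx.ne'
  have hker' : ∀ᵐ z ∂((volume.restrict Ω).prod (volume.restrict Ω)),
      u₁ z.1 - u₂ z.1 = u₁ z.2 - u₂ z.2 := by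
    filter_upwards [hker] with z hz
    rcases hz with hz | hz
    · have hzero := ((Real.rpow_eq_zero_iff_of_nonneg (norm_nonneg _)).1 (inv_eq_zero.1 hz)).1
      rw [sub_eq_zero.1 (norm_eq_zero.1 hzero)]
    · linarith
  have : NeZero (volume.restrict Ω) :=
    ⟨fun h => (hop.measure_pos volume hne).ne' (Measure.restrict_eq_zero.1 h)⟩
  refine ⟨?_, ?_, exists_ae_eq_const_of_ae_ae_eq (Measure.ae_ae_of_ae_prod hker'), hbdry'⟩
  · rw [gagliardoEnergy_eq_lintegral_prod Ω s p (v := fun x => u₁ x - u₂ x)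
      (hm₁.sub hm₂)]
    refine (lintegral_congr_ae ?_).trans lintegral_zero
    filter_upwards [hker'] with z hz
    simp [hz, Real.zero_rpow hp0]
  · refine (lintegral_congr_ae ?_).trans lintegral_zero
    filter_upwards [hbdry'] with x hx
    simp [hx, Real.zero_rpow hp0]
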